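/- Let P be an orthoposet, M = P*′ its orthodual space, and C the closure on M generated by {UP_M(p) : p ∈ P}. Then the map p ↦ UP_M(p) is an order isomorphism from P onto CO(M, C), the collection of C-clopen subsets of M ordered by set inclusion; moreover it sends p′ to the set complement M \ UP_M(p). -/

import Mathlib

open Set

variable {P : Type*}

/-- `UP_A(p) = {x ∈ A : x p = 1}`, as a subset of the subtype `↥A`. -/
def UPa [PartialOrder P] (A : Set (P →o Bool)) (p : P) : Set ↥A := {x | x.1 p = true}

/-- `LO_A(p) = {x ∈ A : x p = 0}`, as a subset of the subtype `↥A`. -/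
def LOa [PartialOrder P] (A : Set (P →o Bool)) (p : P) : Set ↥A := {x | x.1 p = false}

/-- The closure operator generated by a family `K` of subsets of `M`:
`C(X) = ⋂ {k ∈ K : X ⊆ k}` (the empty intersection being `M`). -/
def closGen {M : Type*} (K : Set (Set M)) (X : Set M) : Set M := ⋂₀ {k ∈ K | X ⊆ k}

/-- The closure `C1` on `A` generated by `{UP_A(p) : p ∈ P}`. -/
def C1a [PartialOrder P] (A : Set (P →o Bool)) : Set ↥A → Set ↥A :=
  closGen (Set.range (UPa A))

/-- The closure `C2` on `A` generated by `{LO_A(p) : p ∈ P}`. -/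
def C2a [PartialOrder P] (A : Set (P →o Bool)) : Set ↥A → Set ↥A :=
  closGen (Set.range (LOa A))

/-- `C1O2(A)`: the subsets of `A` that are `C1`-closed and `C2`-open. -/
def C1O2 [PartialOrder P] (A : Set (P →o Bool)) : Set (Set ↥A) :=
  {B | C1a A B = B ∧ C2a A Bᶜ = Bᶜ}

/-- An `A`-ideal: an intersection of kernels of elements of some `S ⊆ A`. -/
def IsIdealOf [PartialOrder P] (A : Set (P →o Bool)) (I : Set P) : Prop :=
  ∃ S ⊆ A, I = ⋂ x ∈ S, {p : P | x p = false}

/-- An `A`-filter: an intersection of co-kernels of elements of some `S ⊆ A`. -/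
def IsFilterOf [PartialOrder P] (A : Set (P →o Bool)) (F : Set P) : Prop :=
  ∃ S ⊆ A, F = ⋂ x ∈ S, {p : P | x p = true}

/-- `A` is full: for all `p ≰ q` some `x ∈ A` has `x p = 1`, `x q = 0`. -/
def IsFullSet [PartialOrder P] (A : Set (P →o Bool)) : Prop :=
  ∀ p q : P, ¬ p ≤ q → ∃ x ∈ A, x p = true ∧ x q = false

/-- `A` is separating: any disjoint `A`-ideal and `A`-filter are separated by some `x ∈ A`. -/
def IsSeparatingSet [PartialOrder P] (A : Set (P →o Bool)) : Prop :=
  ∀ I F : Set P, IsIdealOf A I → IsFilterOf A F → I ∩ F = ∅ →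
    ∃ x ∈ A, (∀ p ∈ I, x p = false) ∧ (∀ p ∈ F, x p = true)

/-- An orthocomplementation on a bounded poset: antitone, involutive, and
`⊤` is the least upper bound of `{p, p′}` while `⊥` is the greatest lower bound. -/
def IsOrtho [PartialOrder P] [BoundedOrder P] (oc : P → P) : Prop :=
  Antitone oc ∧ (∀ p, oc (oc p) = p) ∧
    (∀ p, IsLUB {p, oc p} ⊤) ∧ (∀ p, IsGLB {p, oc p} ⊥)

/-- The orthodual space `P*′`: monotone maps with `x(p′) = 1 - x(p)`. -/
def OrthoDual [PartialOrder P] (oc : P → P) : Set (P →o Bool) :=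
  {x | ∀ p, x (oc p) = ! x p}

/-- `CO(A, C1)`: the subsets of `A` that are clopen for the closure `C1`. -/
def COsets [PartialOrder P] (A : Set (P →o Bool)) : Set (Set ↥A) :=
  {B | C1a A B = B ∧ C1a A Bᶜ = Bᶜ}

/-- A set is linked if no element lies below the orthocomplement of another (or of itself). -/
def IsLinked [PartialOrder P] (oc : P → P) (S : Set P) : Prop :=
  ∀ a ∈ S, ∀ b ∈ S, ¬ a ≤ oc b

section Ortho

variable [PartialOrder P] {oc : P → P}

/-- A linked set is contained in a maximal linked set. -/
theorem IsLinked.exists_maximal {S : Set P} (hS : IsLinked oc S) :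
    ∃ T, S ⊆ T ∧ Maximal (· ∈ {T | IsLinked oc T}) T := by
  refine zorn_subset_nonempty {T | IsLinked oc T} (fun c hc hchain _ => ?_) S hS
  refine ⟨⋃₀ c, ?_, fun s hs => subset_sUnion_of_mem hs⟩
  rintro a ⟨s, hs, ha⟩ b ⟨t, ht, hb⟩
  rcases hchain.total hs ht with hst | hts
  · exact hc ht a (hst ha) b hb
  · exact hc hs a ha b (hts hb)

theorem UPa_mono (A : Set (P →o Bool)) : Monotone (UPa A) :=
  fun _ _ hpq x hx => x.1.monotone hpq hx

theorem IsFullSet.le_iff_UPa_subset {A : Set (P →o Bool)} (hA : IsFullSet A) {p q : P} :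
    p ≤ q ↔ UPa A p ⊆ UPa A q := by
  refine ⟨fun hpq => UPa_mono A hpq, fun hsub => ?_⟩
  by_contra hpq
  obtain ⟨x, hx, hxp, hxq⟩ := hA p q hpq
  have : x q = true := hsub (a := ⟨x, hx⟩) hxp
  simp [hxq] at this

theorem C1a_UPa (A : Set (P →o Bool)) (p : P) : C1a A (UPa A p) = UPa A p :=
  Set.Subset.antisymm (sInter_subset_of_mem ⟨mem_range_self p, Subset.rfl⟩)
    (subset_sInter fun _ hk => hk.2)

theorem mem_of_C1a_eq {A : Set (P →o Bool)} {B : Set ↥A} (hB : C1a A B = B) {x : ↥A}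
    (hx : ∀ p, B ⊆ UPa A p → x ∈ UPa A p) : x ∈ B := by
  rw [← hB]
  rintro _ ⟨⟨p, rfl⟩, hp⟩
  exact hx p hp

theorem UPa_orthoDual_compl (p : P) :
    UPa (OrthoDual oc) (oc p) = (UPa (OrthoDual oc) p)ᶜ := by
  ext x
  simp [UPa, x.2 p]

theorem UPa_mem_COsets (p : P) : UPa (OrthoDual oc) p ∈ COsets (OrthoDual oc) := by
  refine ⟨C1a_UPa _ p, ?_⟩
  rw [← UPa_orthoDual_compl, C1a_UPa]

variable [BoundedOrder P]

theorem IsOrtho.le_swap (h : IsOrtho oc) {a b : P} (hab : a ≤ oc b) : b ≤ oc a := by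
  simpa only [h.2.1] using h.1 hab

theorem IsOrtho.eq_bot_of_le (h : IsOrtho oc) {a : P} (ha : a ≤ oc a) : a = ⊥ := by
  refine le_bot_iff.1 ((h.2.2.2 a).2 ?_)
  simp [lowerBounds, ha]

theorem IsOrtho.eq_top_of_le (h : IsOrtho oc) {a : P} (ha : oc a ≤ a) : a = ⊤ := by
  refine top_le_iff.1 ((h.2.2.1 a).2 ?_)
  simp [upperBounds, ha]

theorem OrthoDual.apply_top {x : P →o Bool} (hx : x ∈ OrthoDual oc) : x ⊤ = true := by
  have h1 := hx ⊤
  have h2 := x.monotone (le_top : oc ⊤ ≤ ⊤)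
  rw [h1] at h2
  revert h2
  cases x ⊤ <;> decide

theorem OrthoDual.apply_bot {x : P →o Bool} (hx : x ∈ OrthoDual oc) : x ⊥ = false := by
  have h1 := hx ⊥
  have h2 := x.monotone (bot_le : ⊥ ≤ oc ⊥)
  rw [h1] at h2
  revert h2
  cases x ⊥ <;> decide

/-- An element outside a maximal linked set `T` is `⊥` or lies below the orthocomplement of
an element of `T`. -/
theorem IsOrtho.eq_bot_or_le_of_notMem (h : IsOrtho oc) {T : Set P}
    (hT : Maximal (· ∈ {T | IsLinked oc T}) T) {p : P} (hp : p ∉ T) :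
    p = ⊥ ∨ ∃ a ∈ T, a ≤ oc p := by
  by_contra! hcon
  refine hp (hT.2 (y := insert p T) ?_ (subset_insert p T) (mem_insert p T))
  rintro a (rfl | ha) b (rfl | hb) hab
  · exact hcon.1 (h.eq_bot_of_le hab)
  · exact hcon.2 b hb (h.le_swap hab)
  · exact hcon.2 a ha hab
  · exact hT.1 a ha b hb hab

/-- A nonempty linked set is contained in the co-kernel of an element of the orthodual. -/
theorem IsOrtho.exists_mem_orthoDual (h : IsOrtho oc) {S : Set P} (hS : IsLinked oc S)
    (hne : S.Nonempty) : ∃ x ∈ OrthoDual oc, ∀ p ∈ S, x p = true := by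
  classical
  obtain ⟨T, hST, hT⟩ := hS.exists_maximal
  obtain ⟨c, hc⟩ : T.Nonempty := hne.mono hST
  have hlinked : IsLinked oc T := hT.1
  have below : ∀ p ∉ T, ∃ a ∈ T, a ≤ oc p := by
    intro p hp
    rcases h.eq_bot_or_le_of_notMem hT hp with rfl | h'
    · exact ⟨c, hc, h.le_swap bot_le⟩
    · exact h'
  have upper : ∀ p q : P, p ≤ q → p ∈ T → q ∈ T := by
    intro p q hpq hp
    by_contra hq
    obtain ⟨a, ha, haq⟩ := below q hq
    exact hlinked a ha p hp (haq.trans (h.1 hpq))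
  have compl : ∀ p, oc p ∈ T ↔ p ∉ T := by
    refine fun p => ⟨fun hp hp' => hlinked _ hp p hp' le_rfl, fun hp => ?_⟩
    obtain ⟨a, ha, hap⟩ := below p hp
    exact upper a _ hap ha
  have hmono : Monotone fun p => decide (p ∈ T) := fun p q hpq hp =>
    decide_eq_true (upper p q hpq (of_decide_eq_true hp))
  refine ⟨⟨fun p => decide (p ∈ T), hmono⟩, fun p => ?_, fun p hp => decide_eq_true (hST hp)⟩
  simp [compl]

theorem IsOrtho.isFullSet_orthoDual (h : IsOrtho oc) : IsFullSet (OrthoDual oc) := by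
  intro p q hpq
  have hS : IsLinked oc {p, oc q} := by
    rintro a (rfl | rfl) b (rfl | rfl) hab
    · exact hpq (h.eq_bot_of_le hab ▸ bot_le)
    · exact hpq (by simpa only [h.2.1] using hab)
    · exact hpq (by simpa only [h.2.1] using h.le_swap hab)
    · rw [h.2.1] at hab
      exact hpq (h.eq_top_of_le hab ▸ le_top)
  obtain ⟨x, hx, hxS⟩ := h.exists_mem_orthoDual hS (insert_nonempty _ _)
  refine ⟨x, hx, hxS p (by simp), ?_⟩
  have := hxS (oc q) (by simp)
  rw [hx q] at this
  simpa using this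

theorem UPa_orthoDual_top : UPa (OrthoDual oc) ⊤ = univ :=
  eq_univ_of_forall fun x => OrthoDual.apply_top x.2

theorem UPa_orthoDual_bot : UPa (OrthoDual oc) ⊥ = ∅ := by
  ext x
  simp [UPa, OrthoDual.apply_bot x.2]

theorem IsOrtho.exists_UPa_eq (h : IsOrtho oc) {B : Set ↥(OrthoDual oc)}
    (hB : B ∈ COsets (OrthoDual oc)) : ∃ p : P, UPa (OrthoDual oc) p = B := by
  have disj : ∀ {a b : P}, a ≤ oc b →
      UPa (OrthoDual oc) a ⊆ (UPa (OrthoDual oc) b)ᶜ := by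
    intro a b hab
    rw [← UPa_orthoDual_compl]
    exact UPa_mono _ hab
  have mixed : ∀ {a b : P}, a ≤ oc b → B ⊆ UPa (OrthoDual oc) a →
      Bᶜ ⊆ UPa (OrthoDual oc) b → UPa (OrthoDual oc) a = B := fun hab ha hb =>
    ((disj hab).trans (compl_subset_comm.1 hb)).antisymm ha
  have hnot : ¬ IsLinked oc
      {p | B ⊆ UPa (OrthoDual oc) p ∨ Bᶜ ⊆ UPa (OrthoDual oc) p} := by
    intro hS
    obtain ⟨x, hx, hxS⟩ := h.exists_mem_orthoDual hS
      ⟨⊤, Or.inl (UPa_orthoDual_top (oc := oc) ▸ subset_univ B)⟩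
    have h1 : (⟨x, hx⟩ : ↥(OrthoDual oc)) ∈ B :=
      mem_of_C1a_eq hB.1 fun p hp => hxS p (Or.inl hp)
    have h2 : (⟨x, hx⟩ : ↥(OrthoDual oc)) ∈ Bᶜ :=
      mem_of_C1a_eq hB.2 fun p hp => hxS p (Or.inr hp)
    exact h2 h1
  simp only [IsLinked, not_forall, not_not] at hnot
  obtain ⟨a, ha | ha, b, hb | hb, hab⟩ := hnot
  · refine ⟨⊥, UPa_orthoDual_bot.trans (eq_empty_of_forall_notMem fun x hx => ?_).symm⟩
    exact disj hab (ha hx) (hb hx)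
  · exact ⟨a, mixed hab ha hb⟩
  · exact ⟨b, mixed (h.le_swap hab) hb ha⟩
  · refine ⟨⊤, UPa_orthoDual_top.trans (eq_univ_of_forall fun x => ?_).symm⟩
    by_contra hx
    exact disj hab (ha hx) (hb hx)

end Ortho

/-- for an orthoposet `P` with orthodual space `M = P*′` and closure
`C` generated by the `UP_M(p)`, the map `p ↦ UP_M(p)` is an order isomorphism from
`P` onto `CO(M, C)` ordered by inclusion, sending `p′` to the complement of `UP_M(p)`. -/
theorem stmt10 [PartialOrder P] [BoundedOrder P] (oc : P → P) (hoc : IsOrtho oc) :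
    (∀ p : P, UPa (OrthoDual oc) p ∈ COsets (OrthoDual oc)) ∧
    Function.Injective (UPa (OrthoDual oc)) ∧
    (∀ B ∈ COsets (OrthoDual oc), ∃ p : P, UPa (OrthoDual oc) p = B) ∧
    (∀ p q : P, p ≤ q ↔ UPa (OrthoDual oc) p ⊆ UPa (OrthoDual oc) q) ∧
    (∀ p : P, UPa (OrthoDual oc) (oc p) = (UPa (OrthoDual oc) p)ᶜ) := by
  have hfull := hoc.isFullSet_orthoDual
  refine ⟨UPa_mem_COsets, fun p q hpq => ?_, fun B hB => hoc.exists_UPa_eq hB,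
    fun p q => hfull.le_iff_UPa_subset, UPa_orthoDual_compl⟩
  exact le_antisymm (hfull.le_iff_UPa_subset.2 hpq.subset)
    (hfull.le_iff_UPa_subset.2 hpq.symm.subset)
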